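/- Let α, β > 1 be real numbers with α + β = 4/(2−γ), and set θ = min(α, β). Then there exist constants ε₀ ∈ (0,1) and C > 0 (depending only on γ, α, β and c₀) such that for all a_i, a_j ∈ ℝ³ and λ_i, λ_j > 0 with ε_ij ≤ ε₀, ∫_{ℝ³} δ_{a_i,λ_i}(u)^α · δ_{a_j,λ_j}(u)^β du ≤ C·ε_ij^θ·(log(1/ε_ij))^{θ(2−γ)/2}. -/

import Mathlib

open MeasureTheory Real

/-- The standard bubble
`δ_{a,λ}(x,y,t) = c₀·λ^{2−γ}·[(1 + λ²((x−x_a)² + (y−y_a)²))² + λ⁴(t − t_a + 2(x_a y − x y_a))²]^{−(2−γ)/2}`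
on `ℝ³`. -/
noncomputable def bubble (γ c₀ : ℝ) (a : ℝ × ℝ × ℝ) (l : ℝ) (u : ℝ × ℝ × ℝ) : ℝ :=
  c₀ * l ^ (2 - γ) *
    ((1 + l ^ 2 * ((u.1 - a.1) ^ 2 + (u.2.1 - a.2.1) ^ 2)) ^ 2
        + l ^ 4 * (u.2.2 - a.2.2 + 2 * (a.1 * u.2.1 - u.1 * a.2.1)) ^ 2) ^ (-(2 - γ) / 2)

/-- The homogeneous (gauge) distance
`d(a_i,a_j) = [((x_i−x_j)² + (y_i−y_j)²)² + (t_i − t_j + 2x_j y_i − 2x_i y_j)²]^{1/4}`. -/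
noncomputable def gdist (ai aj : ℝ × ℝ × ℝ) : ℝ :=
  (((ai.1 - aj.1) ^ 2 + (ai.2.1 - aj.2.1) ^ 2) ^ 2
      + (ai.2.2 - aj.2.2 + 2 * aj.1 * ai.2.1 - 2 * ai.1 * aj.2.1) ^ 2) ^ ((1 : ℝ) / 4)

/-- The interaction quantity
`ε_ij = (λ_i/λ_j + λ_j/λ_i + λ_i λ_j d(a_i,a_j)²)^{−(2−γ)}`. -/
noncomputable def epsb (γ : ℝ) (ai aj : ℝ × ℝ × ℝ) (li lj : ℝ) : ℝ :=
  (li / lj + lj / li + li * lj * gdist ai aj ^ 2) ^ (-(2 - γ))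

lemma lintegral_rpow_neg_one_sub_le {B k s : ℝ} (hB : 0 < B) (hk : 0 < k) (hs : 0 ≤ s) (c : ℝ) :
    ∫⁻ t : ℝ, ENNReal.ofReal ((B ^ 2 + (k * t + c) ^ 2) ^ (-1 - s))
      ≤ ENNReal.ofReal (π / k * B ^ (-1 - 2 * s)) := by
  have hpt : ∀ t : ℝ, (B ^ 2 + (k * t + c) ^ 2) ^ (-1 - s)
      ≤ B ^ (-2 - 2 * s) * (1 + (k / B * (t + c / k)) ^ 2)⁻¹ := by
    intro t
    have h0 : (0 : ℝ) < 1 + (k / B * (t + c / k)) ^ 2 := by positivity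
    have h1 : B ^ 2 + (k * t + c) ^ 2 = B ^ 2 * (1 + (k / B * (t + c / k)) ^ 2) := by
      field_simp
    have h2 : (B ^ 2 : ℝ) ^ (-1 - s) = B ^ (-2 - 2 * s) := by
      rw [← rpow_natCast, ← rpow_mul hB.le]; congr 1; push_cast; ring
    rw [h1, mul_rpow (by positivity) h0.le, h2, ← rpow_neg_one (1 + _)]
    gcongr
    · nlinarith [sq_nonneg (k / B * (t + c / k))]
    · linarith
  have hint : Integrable fun t : ℝ => B ^ (-2 - 2 * s) * (1 + (k / B * (t + c / k)) ^ 2)⁻¹ :=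
    ((integrable_inv_one_add_sq.comp_mul_left' (by positivity : k / B ≠ 0)).comp_add_right
      (c / k)).const_mul _
  calc _ ≤ ∫⁻ t : ℝ, ENNReal.ofReal (B ^ (-2 - 2 * s) * (1 + (k / B * (t + c / k)) ^ 2)⁻¹) :=
        lintegral_mono fun t => ENNReal.ofReal_le_ofReal (hpt t)
    _ = ENNReal.ofReal (∫ t : ℝ, B ^ (-2 - 2 * s) * (1 + (k / B * (t + c / k)) ^ 2)⁻¹) :=
        (ofReal_integral_eq_lintegral_ofReal hint (.of_forall fun t => by positivity)).symm
    _ = ENNReal.ofReal (π / k * B ^ (-1 - 2 * s)) := by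
        congr 1
        rw [integral_const_mul,
          integral_add_right_eq_self (fun t : ℝ => (1 + (k / B * t) ^ 2)⁻¹) (c / k),
          Measure.integral_comp_mul_left (fun t : ℝ => (1 + t ^ 2)⁻¹) (k / B),
          integral_univ_inv_one_add_sq, abs_of_pos (by positivity), smul_eq_mul,
          show -1 - 2 * s = -2 - 2 * s + 1 by ring, rpow_add_one hB.ne']
        field_simp

lemma integrable_one_add_abs_rpow {r : ℝ} (hr : 0 < r) :
    Integrable fun x : ℝ => (1 + |x|) ^ (-1 - r) := by
  have h := integrable_one_add_norm (E := ℝ) (μ := volume) (r := 1 + r) (by simpa using hr)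
  simpa only [neg_add', norm_eq_abs] using h

lemma integral_one_add_abs_rpow {r : ℝ} (hr : 0 < r) :
    ∫ x : ℝ, (1 + |x|) ^ (-1 - r) = 2 / r := by
  rw [integral_comp_abs (f := fun x => (1 + x) ^ (-1 - r))]
  have hderiv : ∀ x ∈ Set.Ici (0 : ℝ), HasDerivAt (fun x : ℝ => -(1 / r) * (1 + x) ^ (-r))
      ((1 + x) ^ (-1 - r)) x := by
    intro x hx
    have hx' : (1 + x) ≠ 0 := by have : (0 : ℝ) ≤ x := hx; positivity
    refine ((((hasDerivAt_id x).const_add 1).rpow_const (p := -r) (.inl hx')).const_mul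
      (-(1 / r))).congr_deriv ?_
    rw [id, show -r - 1 = -1 - r by ring]
    field_simp
  have hlim : Filter.Tendsto (fun x : ℝ => -(1 / r) * (1 + x) ^ (-r)) Filter.atTop (nhds 0) := by
    simpa using ((tendsto_rpow_neg_atTop hr).comp
      (Filter.tendsto_atTop_add_const_left _ 1 Filter.tendsto_id)).const_mul (-(1 / r))
  have hint : IntegrableOn (fun x : ℝ => (1 + x) ^ (-1 - r)) (Set.Ioi 0) :=
    (integrable_one_add_abs_rpow hr).integrableOn.congr_fun
      (fun x hx => by simp only [abs_of_pos (Set.mem_Ioi.mp hx)]) measurableSet_Ioi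
  rw [integral_Ioi_of_hasDerivAt_of_tendsto' hderiv hint hlim]
  simp
  field_simp

lemma lintegral_one_add_sq_rpow_le {s : ℝ} (hs : 0 < s) (hs1 : s ≤ 1) {k : ℝ} (hk : 0 < k) (c : ℝ) :
    ∫⁻ x : ℝ, ENNReal.ofReal ((1 + (k * x + c) ^ 2) ^ (-(1 / 2) - 2 * s))
      ≤ ENNReal.ofReal (4 / (k * s)) := by
  have hpt : ∀ x : ℝ, (1 + (k * x + c) ^ 2) ^ (-(1 / 2) - 2 * s)
      ≤ 8 * (1 + |k * (x + c / k)|) ^ (-1 - 4 * s) := by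
    intro x
    have h1 : k * (x + c / k) = k * x + c := by field_simp
    rw [h1]
    set y := k * x + c
    have h2 : (1 + |y|) ^ 2 / 2 ≤ 1 + y ^ 2 := by
      nlinarith [sq_nonneg (|y| - 1), sq_abs y]
    calc (1 + y ^ 2) ^ (-(1 / 2) - 2 * s) ≤ ((1 + |y|) ^ 2 / 2) ^ (-(1 / 2) - 2 * s) :=
          rpow_le_rpow_of_nonpos (by positivity) h2 (by linarith)
      _ = (1 + |y|) ^ (-1 - 4 * s) * 2 ^ (1 / 2 + 2 * s) := by
          rw [div_rpow (by positivity) (by norm_num), ← rpow_natCast, ← rpow_mul (by positivity),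
            div_eq_mul_inv, ← rpow_neg (by norm_num)]
          congr 2 <;> push_cast <;> ring
      _ ≤ (1 + |y|) ^ (-1 - 4 * s) * 2 ^ (3 : ℝ) := by
          gcongr
          · norm_num
          · linarith
      _ = _ := by norm_num; ring
  have hint : Integrable fun x : ℝ => 8 * (1 + |k * (x + c / k)|) ^ (-1 - 4 * s) :=
    (((integrable_one_add_abs_rpow (by positivity)).comp_mul_left' hk.ne').comp_add_right
      (c / k)).const_mul _
  calc _ ≤ ∫⁻ x : ℝ, ENNReal.ofReal (8 * (1 + |k * (x + c / k)|) ^ (-1 - 4 * s)) :=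
        lintegral_mono fun x => ENNReal.ofReal_le_ofReal (hpt x)
    _ = ENNReal.ofReal (∫ x : ℝ, 8 * (1 + |k * (x + c / k)|) ^ (-1 - 4 * s)) :=
        (ofReal_integral_eq_lintegral_ofReal hint (.of_forall fun t => by positivity)).symm
    _ = _ := by
        congr 1
        rw [integral_const_mul,
          integral_add_right_eq_self (fun t : ℝ => (1 + |k * t|) ^ (-1 - 4 * s)) (c / k),
          Measure.integral_comp_mul_left (fun t : ℝ => (1 + |t|) ^ (-1 - 4 * s)) k,
          integral_one_add_abs_rpow (by positivity), abs_of_pos (by positivity), smul_eq_mul]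
        field_simp
        norm_num

/-- The denominator of the bubble concentrated at `a` with parameter `l`. -/
noncomputable def bubbleForm (a : ℝ × ℝ × ℝ) (l : ℝ) (u : ℝ × ℝ × ℝ) : ℝ :=
  (1 + l ^ 2 * ((u.1 - a.1) ^ 2 + (u.2.1 - a.2.1) ^ 2)) ^ 2
    + l ^ 4 * (u.2.2 - a.2.2 + 2 * (a.1 * u.2.1 - u.1 * a.2.1)) ^ 2

lemma one_le_bubbleForm (a : ℝ × ℝ × ℝ) (l : ℝ) (u : ℝ × ℝ × ℝ) : 1 ≤ bubbleForm a l u := by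
  unfold bubbleForm
  have h : 0 ≤ l ^ 2 * ((u.1 - a.1) ^ 2 + (u.2.1 - a.2.1) ^ 2) := by positivity
  have h' : 0 ≤ l ^ 4 * (u.2.2 - a.2.2 + 2 * (a.1 * u.2.1 - u.1 * a.2.1)) ^ 2 := by positivity
  nlinarith

lemma bubbleForm_pos (a : ℝ × ℝ × ℝ) (l : ℝ) (u : ℝ × ℝ × ℝ) : 0 < bubbleForm a l u :=
  one_pos.trans_le (one_le_bubbleForm a l u)

@[fun_prop]
lemma measurable_bubbleForm (a : ℝ × ℝ × ℝ) (l : ℝ) : Measurable (bubbleForm a l) := by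
  unfold bubbleForm; fun_prop

lemma lintegral_bubbleForm_rpow_le (a : ℝ × ℝ × ℝ) {l s : ℝ} (hl : 0 < l) (hs : 0 < s)
    (hs1 : s ≤ 1) :
    ∫⁻ u, ENNReal.ofReal (l ^ 4 * bubbleForm a l u ^ (-1 - s)) ≤
      ENNReal.ofReal (4 * π ^ 2 / s) := by
  have ht : ∀ x y : ℝ, ∫⁻ t : ℝ, ENNReal.ofReal (l ^ 4 * bubbleForm a l (x, y, t) ^ (-1 - s)) ≤
      ENNReal.ofReal
        (π * l ^ 2 * (1 + l ^ 2 * ((x - a.1) ^ 2 + (y - a.2.1) ^ 2)) ^ (-1 - 2 * s)) := by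
    intro x y
    have h := lintegral_rpow_neg_one_sub_le
      (B := 1 + l ^ 2 * ((x - a.1) ^ 2 + (y - a.2.1) ^ 2)) (by positivity)
      (pow_pos hl 2) hs.le (l ^ 2 * (- a.2.2 + 2 * (a.1 * y - x * a.2.1)))
    calc _ = ∫⁻ t : ℝ, ENNReal.ofReal (l ^ 4) *
          ENNReal.ofReal (((1 + l ^ 2 * ((x - a.1) ^ 2 + (y - a.2.1) ^ 2)) ^ 2 +
            (l ^ 2 * t + l ^ 2 * (- a.2.2 + 2 * (a.1 * y - x * a.2.1))) ^ 2) ^ (-1 - s)) := by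
          refine lintegral_congr fun t => ?_
          rw [ENNReal.ofReal_mul (by positivity)]
          congr 3
          simp only [bubbleForm]
          ring
      _ ≤ _ := by
          rw [lintegral_const_mul' _ _ ENNReal.ofReal_ne_top]
          refine (mul_le_mul_right h _).trans_eq ?_
          rw [← ENNReal.ofReal_mul (by positivity)]
          congr 1
          field_simp
  have hy : ∀ x : ℝ, ∫⁻ y : ℝ, ENNReal.ofReal
        (π * l ^ 2 * (1 + l ^ 2 * ((x - a.1) ^ 2 + (y - a.2.1) ^ 2)) ^ (-1 - 2 * s)) ≤
      ENNReal.ofReal (π ^ 2 * l * (1 + (l * x + -l * a.1) ^ 2) ^ (-(1 / 2) - 2 * s)) := by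
    intro x
    have hsq : √(1 + (l * x + -l * a.1) ^ 2) ^ 2 = 1 + (l * x + -l * a.1) ^ 2 :=
      sq_sqrt (by positivity)
    have h := lintegral_rpow_neg_one_sub_le (B := √(1 + (l * x + -l * a.1) ^ 2))
      (s := 2 * s) (by positivity) hl (by positivity) (-l * a.2.1)
    calc _ = ∫⁻ y : ℝ, ENNReal.ofReal (π * l ^ 2) *
          ENNReal.ofReal ((√(1 + (l * x + -l * a.1) ^ 2) ^ 2 +
            (l * y + -l * a.2.1) ^ 2) ^ (-1 - 2 * s)) := by
          refine lintegral_congr fun t => ?_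
          rw [ENNReal.ofReal_mul (by positivity), hsq]
          congr 3
          ring
      _ ≤ _ := by
          rw [lintegral_const_mul' _ _ ENNReal.ofReal_ne_top]
          refine (mul_le_mul_right h _).trans_eq ?_
          rw [← ENNReal.ofReal_mul (by positivity), sqrt_eq_rpow, ← rpow_mul (by positivity),
            show 1 / 2 * (-1 - 2 * (2 * s)) = -(1 / 2) - 2 * s by ring]
          congr 1
          field_simp
  calc _ = ∫⁻ x : ℝ, ∫⁻ y : ℝ, ∫⁻ t : ℝ,
        ENNReal.ofReal (l ^ 4 * bubbleForm a l (x, y, t) ^ (-1 - s)) := by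
        rw [Measure.volume_eq_prod, lintegral_prod _ (by fun_prop)]
        refine lintegral_congr fun x => ?_
        rw [Measure.volume_eq_prod, lintegral_prod _ (by fun_prop)]
    _ ≤ ∫⁻ x : ℝ, ENNReal.ofReal
          (π ^ 2 * l * (1 + (l * x + -l * a.1) ^ 2) ^ (-(1 / 2) - 2 * s)) :=
        lintegral_mono fun x => (lintegral_mono fun y => ht x y).trans (hy x)
    _ = ENNReal.ofReal (π ^ 2 * l) * ∫⁻ x : ℝ, ENNReal.ofReal
          ((1 + (l * x + -l * a.1) ^ 2) ^ (-(1 / 2) - 2 * s)) := by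
        rw [← lintegral_const_mul' _ _ ENNReal.ofReal_ne_top]
        exact lintegral_congr fun x => ENNReal.ofReal_mul (by positivity)
    _ ≤ _ := by
        refine (mul_le_mul_right (lintegral_one_add_sq_rpow_le hs hs1 hl _) _).trans_eq ?_
        rw [← ENNReal.ofReal_mul (by positivity)]
        congr 1
        field_simp

/-- The base of the power defining `epsb`. -/
noncomputable def interactionBase (ai aj : ℝ × ℝ × ℝ) (li lj : ℝ) : ℝ :=
  li / lj + lj / li + li * lj * gdist ai aj ^ 2

lemma gdist_comm (ai aj : ℝ × ℝ × ℝ) : gdist ai aj = gdist aj ai := by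
  unfold gdist; congr 1; ring

lemma interactionBase_comm (ai aj : ℝ × ℝ × ℝ) (li lj : ℝ) :
    interactionBase ai aj li lj = interactionBase aj ai lj li := by
  unfold interactionBase; rw [gdist_comm]; ring

lemma two_le_interactionBase (ai aj : ℝ × ℝ × ℝ) {li lj : ℝ} (hi : 0 < li) (hj : 0 < lj) :
    2 ≤ interactionBase ai aj li lj := by
  have h1 : 2 ≤ li / lj + lj / li := by
    rw [div_add_div _ _ hj.ne' hi.ne', le_div_iff₀ (by positivity)]
    nlinarith [sq_nonneg (li - lj)]
  have h2 : 0 ≤ li * lj * gdist ai aj ^ 2 := by positivity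
  unfold interactionBase; linarith

/-- A quantity comparable to the square of the gauge distance from `a` to `u`. -/
noncomputable def gaugeSq (a u : ℝ × ℝ × ℝ) : ℝ :=
  (u.1 - a.1) ^ 2 + (u.2.1 - a.2.1) ^ 2 + |u.2.2 - a.2.2 + 2 * (a.1 * u.2.1 - u.1 * a.2.1)|

lemma gaugeSq_nonneg (a u : ℝ × ℝ × ℝ) : 0 ≤ gaugeSq a u := by unfold gaugeSq; positivity

lemma gdist_sq_le (ai aj u : ℝ × ℝ × ℝ) :
    gdist ai aj ^ 2 ≤ 3 * (gaugeSq ai u + gaugeSq aj u) := by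
  obtain ⟨x₁, y₁, t₁⟩ := ai
  obtain ⟨x₂, y₂, t₂⟩ := aj
  obtain ⟨x, y, t⟩ := u
  simp only [gdist, gaugeSq]
  set σ := t - t₁ + 2 * (x₁ * y - x * y₁) with hσ
  set τ := t - t₂ + 2 * (x₂ * y - x * y₂) with hτ
  have h1 := neg_abs_le σ
  have h2 := le_abs_self σ
  have h3 := neg_abs_le τ
  have h4 := le_abs_self τ
  set P := (x - x₁) ^ 2 + (y - y₁) ^ 2 with hP
  set Q := (x - x₂) ^ 2 + (y - y₂) ^ 2 with hQ
  have hz : (x₁ - x₂) ^ 2 + (y₁ - y₂) ^ 2 ≤ 2 * (P + Q) := by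
    nlinarith [sq_nonneg ((x - x₁) + (x - x₂)), sq_nonneg ((y - y₁) + (y - y₂))]
  have ht : |t₁ - t₂ + 2 * x₂ * y₁ - 2 * x₁ * y₂| ≤ P + Q + |σ| + |τ| := by
    have hid : t₁ - t₂ + 2 * x₂ * y₁ - 2 * x₁ * y₂
        = τ - σ - 2 * ((x - x₁) * (y - y₂) - (y - y₁) * (x - x₂)) := by
      rw [hσ, hτ]; ring
    rw [hid, abs_le]
    constructor
    · nlinarith [sq_nonneg ((x - x₁) - (y - y₂)), sq_nonneg ((y - y₁) + (x - x₂))]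
    · nlinarith [sq_nonneg ((x - x₁) + (y - y₂)), sq_nonneg ((y - y₁) - (x - x₂))]
  rw [← rpow_natCast, ← rpow_mul (by positivity),
    show (1 : ℝ) / 4 * (2 : ℕ) = 1 / 2 by norm_num, ← sqrt_eq_rpow]
  refine (sqrt_le_sqrt (y := ((x₁ - x₂) ^ 2 + (y₁ - y₂) ^ 2
    + |t₁ - t₂ + 2 * x₂ * y₁ - 2 * x₁ * y₂|) ^ 2) ?_).trans ?_
  · rw [← sq_abs (t₁ - t₂ + 2 * x₂ * y₁ - 2 * x₁ * y₂)]
    have : 0 ≤ ((x₁ - x₂) ^ 2 + (y₁ - y₂) ^ 2) * |t₁ - t₂ + 2 * x₂ * y₁ - 2 * x₁ * y₂| := by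
      positivity
    nlinarith
  · rw [sqrt_sq (by positivity)]
    linarith [abs_nonneg σ, abs_nonneg τ]

lemma bubbleForm_le (a : ℝ × ℝ × ℝ) (l : ℝ) (u : ℝ × ℝ × ℝ) :
    bubbleForm a l u ≤ (1 + l ^ 2 * gaugeSq a u) ^ 2 := by
  simp only [bubbleForm, gaugeSq]
  set P := (u.1 - a.1) ^ 2 + (u.2.1 - a.2.1) ^ 2 with hP
  set σ := u.2.2 - a.2.2 + 2 * (a.1 * u.2.1 - u.1 * a.2.1)
  rw [← sq_abs σ]
  have : 0 ≤ (1 + l ^ 2 * P) * (l ^ 2 * |σ|) := by positivity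
  nlinarith

lemma le_two_mul_bubbleForm (a : ℝ × ℝ × ℝ) (l : ℝ) (u : ℝ × ℝ × ℝ) :
    (1 + l ^ 2 * gaugeSq a u) ^ 2 ≤ 2 * bubbleForm a l u := by
  simp only [bubbleForm, gaugeSq]
  set P := (u.1 - a.1) ^ 2 + (u.2.1 - a.2.1) ^ 2 with hP
  set σ := u.2.2 - a.2.2 + 2 * (a.1 * u.2.1 - u.1 * a.2.1)
  rw [← sq_abs σ]
  nlinarith [sq_nonneg ((1 + l ^ 2 * P) - (l ^ 2 * |σ|))]

lemma interactionBase_le (ai aj u : ℝ × ℝ × ℝ) {li lj : ℝ} (hi : 0 < li) (hj : 0 < lj) :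
    interactionBase ai aj li lj ≤
      3 * (li / lj * (1 + lj ^ 2 * gaugeSq aj u) + lj / li * (1 + li ^ 2 * gaugeSq ai u)) := by
  have h := mul_le_mul_of_nonneg_left (gdist_sq_le ai aj u) (mul_pos hi hj).le
  have h1 : 0 < li / lj := by positivity
  have h2 : 0 < lj / li := by positivity
  have h3 : li / lj * (1 + lj ^ 2 * gaugeSq aj u) = li / lj + li * lj * gaugeSq aj u := by
    field_simp
  have h4 : lj / li * (1 + li ^ 2 * gaugeSq ai u) = lj / li + li * lj * gaugeSq ai u := by
    field_simp
  unfold interactionBase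
  rw [h3, h4]
  linarith

lemma inv_le_mul_rpow {X r P Q s M N : ℝ} (hX : 0 < X) (hr : 0 < r) (hrX : r ≤ X) (hP : 0 < P)
    (hQ : 0 < Q) (hM : 0 ≤ M) (hPM : P ≤ M ^ 2) (hNQ : N ^ 2 ≤ 2 * Q)
    (hXMN : X ≤ 3 * (r * N + r⁻¹ * M)) (hMN : r⁻¹ * M ≤ r * N) (hs : 0 ≤ s) (hs1 : s ≤ 1) :
    Q⁻¹ ≤ 72 * r ^ 2 * (X ^ 2)⁻¹ * (X ^ 4 / P) ^ s := by
  have h1 : X ≤ 6 * (r * N) := by linarith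
  have h2 : X ^ 2 ≤ 72 * r ^ 2 * Q := by
    calc X ^ 2 ≤ (6 * (r * N)) ^ 2 := by gcongr
      _ = 36 * r ^ 2 * N ^ 2 := by ring
      _ ≤ 36 * r ^ 2 * (2 * Q) := by gcongr
      _ = _ := by ring
  have h3 : M ≤ r ^ 2 * N := by
    rw [inv_mul_le_iff₀ hr] at hMN; linarith
  have h4 : P ≤ 2 * r ^ 4 * Q := by
    calc P ≤ M ^ 2 := hPM
      _ ≤ (r ^ 2 * N) ^ 2 := by gcongr
      _ = r ^ 4 * N ^ 2 := by ring
      _ ≤ r ^ 4 * (2 * Q) := by gcongr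
      _ = _ := by ring
  have h5 : Q⁻¹ ≤ 72 * r ^ 2 * (X ^ 2)⁻¹ := by
    rw [inv_le_iff_one_le_mul₀ hQ]
    field_simp
    linarith
  rcases le_total 1 (X ^ 4 / P) with h | h
  · exact h5.trans (le_mul_of_one_le_right (by positivity) (one_le_rpow h hs))
  · calc Q⁻¹ ≤ 72 * r ^ 2 * (X ^ 2)⁻¹ * (X ^ 4 / P) := by
          rw [inv_le_iff_one_le_mul₀ hQ]
          field_simp
          have : r ^ 4 * Q ≤ r ^ 2 * X ^ 2 * Q := by
            have : r ^ 4 = r ^ 2 * r ^ 2 := by ring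
            rw [this]; gcongr
          have : 0 ≤ r ^ 2 * X ^ 2 * Q := by positivity
          linarith
      _ ≤ _ := by
          gcongr
          simpa using rpow_le_rpow_of_exponent_ge (by positivity) h hs1

/-- The bubble for the exponent `2 / (2 - γ)`, up to a constant. -/
noncomputable def bubbleWeight (a : ℝ × ℝ × ℝ) (l : ℝ) (u : ℝ × ℝ × ℝ) : ℝ :=
  l ^ 2 / bubbleForm a l u

lemma bubbleWeight_pos (a : ℝ × ℝ × ℝ) {l : ℝ} (hl : 0 < l) (u : ℝ × ℝ × ℝ) :
    0 < bubbleWeight a l u := div_pos (pow_pos hl 2) (bubbleForm_pos a l u)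

@[fun_prop]
lemma measurable_bubbleWeight (a : ℝ × ℝ × ℝ) (l : ℝ) : Measurable (bubbleWeight a l) := by
  unfold bubbleWeight; fun_prop

lemma bubbleWeight_mul_le_aux (ai aj u : ℝ × ℝ × ℝ) {li lj s : ℝ} (hi : 0 < li) (hj : 0 < lj)
    (hs : 0 ≤ s) (hs1 : s ≤ 1)
    (h : lj / li * (1 + li ^ 2 * gaugeSq ai u) ≤ li / lj * (1 + lj ^ 2 * gaugeSq aj u)) :
    bubbleWeight ai li u * bubbleWeight aj lj u ≤
      72 * (interactionBase ai aj li lj ^ 2)⁻¹ * (interactionBase ai aj li lj ^ 4) ^ s *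
        (li ^ 4 * bubbleForm ai li u ^ (-1 - s)) := by
  have hX : 0 < interactionBase ai aj li lj := by linarith [two_le_interactionBase ai aj hi hj]
  have hrX : li / lj ≤ interactionBase ai aj li lj := by
    unfold interactionBase
    have : 0 ≤ lj / li + li * lj * gdist ai aj ^ 2 := by positivity
    linarith
  have hbase := interactionBase_le ai aj u hi hj
  have hgi := gaugeSq_nonneg ai u
  have hgj := gaugeSq_nonneg aj u
  rw [← inv_div li lj] at h hbase
  have key := inv_le_mul_rpow hX (by positivity) hrX (bubbleForm_pos ai li u)
    (bubbleForm_pos aj lj u) (by positivity) (bubbleForm_le ai li u)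
    (le_two_mul_bubbleForm aj lj u) hbase h hs hs1
  have hPi := bubbleForm_pos ai li u
  set X := interactionBase ai aj li lj
  set P := bubbleForm ai li u
  set Q := bubbleForm aj lj u
  calc bubbleWeight ai li u * bubbleWeight aj lj u = li ^ 2 * lj ^ 2 * P⁻¹ * Q⁻¹ := by
        simp only [bubbleWeight, P, Q]; ring
    _ ≤ li ^ 2 * lj ^ 2 * P⁻¹ * (72 * (li / lj) ^ 2 * (X ^ 2)⁻¹ * (X ^ 4 / P) ^ s) := by gcongr
    _ = _ := by
        rw [div_rpow (by positivity) hPi.le, sub_eq_add_neg, rpow_add hPi, rpow_neg_one,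
          rpow_neg hPi.le]
        field_simp

lemma bubbleWeight_mul_le (ai aj u : ℝ × ℝ × ℝ) {li lj s : ℝ} (hi : 0 < li) (hj : 0 < lj)
    (hs : 0 ≤ s) (hs1 : s ≤ 1) :
    bubbleWeight ai li u * bubbleWeight aj lj u ≤
      72 * (interactionBase ai aj li lj ^ 2)⁻¹ * (interactionBase ai aj li lj ^ 4) ^ s *
        (li ^ 4 * bubbleForm ai li u ^ (-1 - s) + lj ^ 4 * bubbleForm aj lj u ^ (-1 - s)) := by
  have hX : 0 < interactionBase ai aj li lj := by linarith [two_le_interactionBase ai aj hi hj]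
  have hPi := bubbleForm_pos ai li u
  have hPj := bubbleForm_pos aj lj u
  rcases le_total (lj / li * (1 + li ^ 2 * gaugeSq ai u))
    (li / lj * (1 + lj ^ 2 * gaugeSq aj u)) with h | h
  · refine (bubbleWeight_mul_le_aux ai aj u hi hj hs hs1 h).trans ?_
    gcongr
    exact le_add_of_nonneg_right (by positivity)
  · rw [mul_comm (bubbleWeight ai li u), interactionBase_comm]
    rw [interactionBase_comm] at hX
    refine (bubbleWeight_mul_le_aux aj ai u hj hi hs hs1 h).trans ?_
    gcongr
    exact le_add_of_nonneg_left (by positivity)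

lemma lintegral_bubbleWeight_mul_le (ai aj : ℝ × ℝ × ℝ) {li lj : ℝ} (hi : 0 < li) (hj : 0 < lj) :
    ∫⁻ u, ENNReal.ofReal (bubbleWeight ai li u * bubbleWeight aj lj u) ≤
      ENNReal.ofReal (9216 * π ^ 2 / log 2 * ((interactionBase ai aj li lj ^ 2)⁻¹ *
        log (interactionBase ai aj li lj))) := by
  have h2X := two_le_interactionBase ai aj hi hj
  have hmul := fun u s hs hs1 => bubbleWeight_mul_le ai aj u (s := s) hi hj hs hs1
  set X := interactionBase ai aj li lj
  have hX : 0 < X := by linarith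
  have hlog2 : 0 < log 2 := log_pos one_lt_two
  have hlogX : 0 < log X := log_pos (by linarith)
  set s := log 2 / log X with hs_def
  have hs : 0 < s := by positivity
  have hs1 : s ≤ 1 := (div_le_one hlogX).2 (log_le_log two_pos h2X)
  have hXs : (X ^ 4) ^ s = 16 := by
    rw [← rpow_natCast, ← rpow_mul hX.le, mul_comm, rpow_mul hX.le, rpow_def_of_pos hX,
      hs_def, mul_div_cancel₀ _ hlogX.ne', exp_log two_pos]
    norm_num
  have hP := fun u => bubbleForm_pos ai li u
  have hQ := fun u => bubbleForm_pos aj lj u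
  calc _ ≤ ∫⁻ u, ENNReal.ofReal (1152 * (X ^ 2)⁻¹) *
        (ENNReal.ofReal (li ^ 4 * bubbleForm ai li u ^ (-1 - s))
          + ENNReal.ofReal (lj ^ 4 * bubbleForm aj lj u ^ (-1 - s))) := by
        refine lintegral_mono fun u => ?_
        have hPu := hP u
        have hQu := hQ u
        rw [← ENNReal.ofReal_add (by positivity) (by positivity),
          ← ENNReal.ofReal_mul (by positivity)]
        refine ENNReal.ofReal_le_ofReal ((hmul u s hs.le hs1).trans_eq ?_)
        rw [hXs]; ring
    _ ≤ ENNReal.ofReal (1152 * (X ^ 2)⁻¹) *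
        (ENNReal.ofReal (4 * π ^ 2 / s) + ENNReal.ofReal (4 * π ^ 2 / s)) := by
        rw [lintegral_const_mul' _ _ ENNReal.ofReal_ne_top, lintegral_add_left (by fun_prop)]
        gcongr
        · exact lintegral_bubbleForm_rpow_le ai hi hs hs1
        · exact lintegral_bubbleForm_rpow_le aj hj hs hs1
    _ = _ := by
        rw [← ENNReal.ofReal_add (by positivity) (by positivity),
          ← ENNReal.ofReal_mul (by positivity)]
        congr 1
        rw [hs_def]
        field_simp
        norm_num

lemma lintegral_bubbleWeight_sq_le (a : ℝ × ℝ × ℝ) {l : ℝ} (hl : 0 < l) :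
    ∫⁻ u, ENNReal.ofReal (bubbleWeight a l u ^ 2) ≤ ENNReal.ofReal (4 * π ^ 2) := by
  refine (lintegral_congr fun u => ?_).trans_le
    ((lintegral_bubbleForm_rpow_le a hl one_pos le_rfl).trans_eq (by rw [div_one]))
  congr 1
  rw [bubbleWeight, show (-1 - 1 : ℝ) = -(2 : ℕ) by norm_num, rpow_neg (bubbleForm_pos a l u).le,
    rpow_natCast, div_pow]
  ring

lemma lintegral_bubbleWeight_rpow_mul_rpow_le (ai aj : ℝ × ℝ × ℝ) {li lj p : ℝ} (hi : 0 < li)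
    (hj : 0 < lj) (hp : 0 ≤ p) (hp1 : p ≤ 1) :
    ∫⁻ u, ENNReal.ofReal (bubbleWeight ai li u ^ p * bubbleWeight aj lj u ^ (2 - p)) ≤
      ENNReal.ofReal ((9216 * π ^ 2 / log 2 + 4 * π ^ 2) *
        ((interactionBase ai aj li lj ^ 2)⁻¹ * log (interactionBase ai aj li lj)) ^ p) := by
  have h2X := two_le_interactionBase ai aj hi hj
  have hmul := lintegral_bubbleWeight_mul_le ai aj hi hj
  have hsq := lintegral_bubbleWeight_sq_le aj hj
  set M := (interactionBase ai aj li lj ^ 2)⁻¹ * log (interactionBase ai aj li lj)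
  have hlogX : 0 < log (interactionBase ai aj li lj) := log_pos (by linarith)
  have hM : 0 < M := by positivity
  clear_value M
  have hlog2 : 0 < log 2 := log_pos one_lt_two
  have hpt : ∀ u, bubbleWeight ai li u ^ p * bubbleWeight aj lj u ^ (2 - p) ≤
      M ^ p * (M⁻¹ * (bubbleWeight ai li u * bubbleWeight aj lj u) + bubbleWeight aj lj u ^ 2) := by
    intro u
    have hv := bubbleWeight_pos ai hi u
    have hw := bubbleWeight_pos aj hj u
    set v := bubbleWeight ai li u
    set w := bubbleWeight aj lj u
    have h := geom_mean_le_arith_mean2_weighted hp (sub_nonneg.2 hp1)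
      (p₁ := M⁻¹ * (v * w)) (p₂ := w ^ 2) (by positivity) (by positivity) (by ring)
    have heq : v ^ p * w ^ (2 - p) = M ^ p * ((M⁻¹ * (v * w)) ^ p * (w ^ 2) ^ (1 - p)) := by
      rw [mul_rpow (by positivity) (by positivity), mul_rpow hv.le hw.le, inv_rpow hM.le,
        ← rpow_natCast w 2, ← rpow_mul hw.le, show 2 - p = p + (2 : ℕ) * (1 - p) by push_cast; ring,
        rpow_add hw]
      field_simp
    rw [heq]
    gcongr
    refine h.trans (add_le_add ?_ ?_)
    · exact mul_le_of_le_one_left (by positivity) hp1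
    · exact mul_le_of_le_one_left (by positivity) (by linarith)
  calc _ ≤ ∫⁻ u, ENNReal.ofReal (M ^ p) *
        (ENNReal.ofReal M⁻¹ * ENNReal.ofReal (bubbleWeight ai li u * bubbleWeight aj lj u)
          + ENNReal.ofReal (bubbleWeight aj lj u ^ 2)) := by
        refine lintegral_mono fun u => ?_
        have hv := bubbleWeight_pos ai hi u
        have hw := bubbleWeight_pos aj hj u
        rw [← ENNReal.ofReal_mul (by positivity), ← ENNReal.ofReal_add (by positivity)
          (by positivity), ← ENNReal.ofReal_mul (by positivity)]
        exact ENNReal.ofReal_le_ofReal (hpt u)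
    _ ≤ ENNReal.ofReal (M ^ p) * (ENNReal.ofReal M⁻¹ *
          ENNReal.ofReal (9216 * π ^ 2 / log 2 * M) + ENNReal.ofReal (4 * π ^ 2)) := by
        rw [lintegral_const_mul' _ _ ENNReal.ofReal_ne_top, lintegral_add_left (by fun_prop),
          lintegral_const_mul' _ _ ENNReal.ofReal_ne_top]
        gcongr
    _ = _ := by
        rw [← ENNReal.ofReal_mul (by positivity), ← ENNReal.ofReal_add (by positivity)
          (by positivity), ← ENNReal.ofReal_mul (by positivity)]
        congr 1
        field_simp

lemma bubble_eq {γ c₀ : ℝ} (a : ℝ × ℝ × ℝ) {l : ℝ} (hl : 0 < l) (u : ℝ × ℝ × ℝ) :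
    bubble γ c₀ a l u = c₀ * bubbleWeight a l u ^ ((2 - γ) / 2) := by
  have hQ := bubbleForm_pos a l u
  change c₀ * l ^ (2 - γ) * bubbleForm a l u ^ (-(2 - γ) / 2) = _
  rw [bubbleWeight, div_rpow (by positivity) hQ.le, ← rpow_natCast l 2, ← rpow_mul hl.le,
    neg_div, rpow_neg hQ.le]
  rw [show ((2 : ℕ) : ℝ) * ((2 - γ) / 2) = 2 - γ by push_cast; ring]
  ring

lemma bubble_rpow_eq {γ c₀ : ℝ} (hc₀ : 0 < c₀) (a : ℝ × ℝ × ℝ) {l : ℝ} (hl : 0 < l)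
    (u : ℝ × ℝ × ℝ) (α : ℝ) :
    bubble γ c₀ a l u ^ α = c₀ ^ α * bubbleWeight a l u ^ (α * (2 - γ) / 2) := by
  have hw := bubbleWeight_pos a hl u
  rw [bubble_eq a hl, mul_rpow hc₀.le (by positivity), ← rpow_mul hw.le]
  congr 2; ring

lemma integral_bubble_rpow_mul_rpow_le {γ c₀ α β : ℝ} (hγ : γ < 1) (hc₀ : 0 < c₀) (hα : 0 ≤ α)
    (hαβ : α + β = 4 / (2 - γ)) (hle : α ≤ β) (ai aj : ℝ × ℝ × ℝ) {li lj : ℝ} (hi : 0 < li)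
    (hj : 0 < lj) :
    (∫ u, bubble γ c₀ ai li u ^ α * bubble γ c₀ aj lj u ^ β) ≤
      c₀ ^ (α + β) * (9216 * π ^ 2 / log 2 + 4 * π ^ 2) * epsb γ ai aj li lj ^ α *
        log (1 / epsb γ ai aj li lj) ^ (α * (2 - γ) / 2) := by
  have hn : 1 < 2 - γ := by linarith
  have hsum : α * (2 - γ) + β * (2 - γ) = 4 := by
    rw [← add_mul, hαβ, div_mul_cancel₀]; linarith
  set p := α * (2 - γ) / 2 with hp_def
  have hp : 0 ≤ p := by positivity
  have hp1 : p ≤ 1 := by nlinarith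
  have hq : β * (2 - γ) / 2 = 2 - p := by rw [hp_def]; linarith
  have hmain := lintegral_bubbleWeight_rpow_mul_rpow_le ai aj hi hj hp hp1
  have h2X := two_le_interactionBase ai aj hi hj
  have heps : epsb γ ai aj li lj = interactionBase ai aj li lj ^ (-(2 - γ)) := rfl
  rw [heps]
  set X := interactionBase ai aj li lj
  have hX : 0 < X := by linarith
  have hlogX : 0 < log X := log_pos (by linarith)
  have hlog2 : 0 < log 2 := log_pos one_lt_two
  have hMp : ((X ^ 2)⁻¹ * log X) ^ p ≤
      (X ^ (-(2 - γ))) ^ α * log (1 / X ^ (-(2 - γ))) ^ p := by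
    have h1 : ((X ^ 2)⁻¹) ^ p = (X ^ (-(2 - γ))) ^ α := by
      rw [← rpow_natCast, ← rpow_neg hX.le, ← rpow_mul hX.le, ← rpow_mul hX.le, hp_def]
      congr 1; push_cast; ring
    have h2 : log (1 / X ^ (-(2 - γ))) = (2 - γ) * log X := by
      rw [one_div, log_inv, log_rpow hX]; ring
    rw [mul_rpow (by positivity) hlogX.le, h1, h2]
    gcongr
    exact le_mul_of_one_le_left hlogX.le hn.le
  have hw : ∀ u, 0 ≤ bubbleWeight ai li u ^ p * bubbleWeight aj lj u ^ (2 - p) := fun u =>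
    mul_nonneg (rpow_nonneg (bubbleWeight_pos ai hi u).le _)
      (rpow_nonneg (bubbleWeight_pos aj hj u).le _)
  calc _ = c₀ ^ (α + β) *
        ∫ u, bubbleWeight ai li u ^ p * bubbleWeight aj lj u ^ (2 - p) := by
        rw [← integral_const_mul]
        refine integral_congr_ae (.of_forall fun u => ?_)
        simp only [bubble_rpow_eq hc₀ ai hi, bubble_rpow_eq hc₀ aj hj, hq, rpow_add hc₀]
        ring
    _ ≤ c₀ ^ (α + β) * ((9216 * π ^ 2 / log 2 + 4 * π ^ 2) * ((X ^ 2)⁻¹ * log X) ^ p) := by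
        gcongr
        rw [integral_eq_lintegral_of_nonneg_ae (.of_forall hw)
          (by fun_prop : Measurable _).aestronglyMeasurable]
        exact ENNReal.toReal_le_of_le_ofReal (by positivity) hmain
    _ ≤ c₀ ^ (α + β) * ((9216 * π ^ 2 / log 2 + 4 * π ^ 2) *
        ((X ^ (-(2 - γ))) ^ α * log (1 / X ^ (-(2 - γ))) ^ p)) := by gcongr
    _ = _ := by ring

/-- Lemma A.3(2): for `α, β > 1` with `α + β = 4/(2−γ)` and `θ = min(α,β)`,
`∫ δ_i^α δ_j^β = O(ε_ij^θ (log(1/ε_ij))^{θ(2−γ)/2})`. -/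
theorem bubble_interaction_general_exponents (γ : ℝ) (hγ : γ ∈ Set.Ioo (0 : ℝ) 1)
    (c₀ : ℝ) (hc₀ : 0 < c₀) (α β : ℝ) (hα : 1 < α) (hβ : 1 < β)
    (hαβ : α + β = 4 / (2 - γ)) :
    ∃ ε₀ ∈ Set.Ioo (0 : ℝ) 1, ∃ C : ℝ, 0 < C ∧
      ∀ (ai aj : ℝ × ℝ × ℝ) (li lj : ℝ), 0 < li → 0 < lj →
        epsb γ ai aj li lj ≤ ε₀ →
          (∫ u : ℝ × ℝ × ℝ, bubble γ c₀ ai li u ^ α * bubble γ c₀ aj lj u ^ β)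
            ≤ C * epsb γ ai aj li lj ^ min α β
                * Real.log (1 / epsb γ ai aj li lj) ^ (min α β * (2 - γ) / 2) := by
  have hlog2 : 0 < log 2 := log_pos one_lt_two
  refine ⟨1 / 2, by norm_num, c₀ ^ (α + β) * (9216 * π ^ 2 / log 2 + 4 * π ^ 2), by positivity, ?_⟩
  intro ai aj li lj hi hj _
  rcases le_total α β with h | h
  · rw [min_eq_left h]
    exact integral_bubble_rpow_mul_rpow_le hγ.2 hc₀ (by linarith) hαβ h ai aj hi hj
  · rw [min_eq_right h, add_comm α β]
    have heps : epsb γ ai aj li lj = epsb γ aj ai lj li :=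
      congrArg (· ^ (-(2 - γ))) (interactionBase_comm ai aj li lj)
    simp only [heps, mul_comm (bubble γ c₀ ai li _ ^ α)]
    exact integral_bubble_rpow_mul_rpow_le hγ.2 hc₀ (by linarith) (by linarith) h aj ai hj hi
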